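/- Every finite ultrametric space admits a minimum weight spanning tree that is a Hamiltonian path. -/

import Mathlib

/-- The weight of an edge of the complete graph on a metric space. -/
noncomputable def edgeWeight (X : Type*) [MetricSpace X] : Sym2 X → ℝ :=
  Sym2.lift ⟨fun x y => dist x y, fun x y => dist_comm x y⟩

/-- The total weight of (the edges of) a graph on a finite metric space. -/
noncomputable def graphWeight {X : Type*} [MetricSpace X] [Fintype X]
    (G : SimpleGraph X) : ℝ :=
  ∑ e ∈ G.edgeSet.toFinite.toFinset, edgeWeight X e

/-- A minimum weight spanning tree of the complete weighted graph on a finite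
metric space `X` with weights given by the metric: a tree on the vertex set `X`
whose total weight is minimal among all such trees. -/
def IsMST {X : Type*} [MetricSpace X] [Fintype X] (T : SimpleGraph X) : Prop :=
  T.IsTree ∧ ∀ G : SimpleGraph X, G.IsTree → graphWeight T ≤ graphWeight G

/-- The path graph `x 0 — x 1 — ⋯ — x (n-1)` on `X`. -/
def pathGraphOn {X : Type*} (n : ℕ) (x : ℕ → X) : SimpleGraph X :=
  SimpleGraph.fromRel (fun u v => ∃ i : ℕ, i + 1 < n ∧ u = x i ∧ v = x (i + 1))

/-- Total length of a list of points. -/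
noncomputable def listLen {X : Type*} [MetricSpace X] : List X → ℝ
  | [] => 0
  | [_] => 0
  | a :: b :: l => dist a b + listLen (b :: l)

theorem insert_head {X : Type*} [MetricSpace X]
    (hu : ∀ x y z : X, dist x y ≤ max (dist x z) (dist z y)) (v : X) :
    ∀ (L : List X) (u : X), ∃ L' : List X, L'.Perm (v :: L) ∧
      listLen (u :: L') ≤ listLen (u :: L) + dist u v := by
  intro L
  induction L with
  | nil => exact fun u => ⟨[v], List.Perm.refl _, by simp [listLen]⟩
  | cons b M ih =>
    intro u
    by_cases h : dist u v ≤ dist u b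
    · refine ⟨v :: b :: M, List.Perm.refl _, ?_⟩
      have h1 := hu v b u
      rw [dist_comm v u, max_eq_right h] at h1
      simp only [listLen]
      linarith
    · obtain ⟨L', hp, hw⟩ := ih b
      refine ⟨b :: L', (hp.cons b).trans (List.Perm.swap _ _ _), ?_⟩
      have h1 := hu b v u
      rw [dist_comm b u, max_eq_right (le_of_not_ge h)] at h1
      simp only [listLen]
      linarith

theorem insert_any {X : Type*} [MetricSpace X]
    (hu : ∀ x y z : X, dist x y ≤ max (dist x z) (dist z y)) (v u : X) :
    ∀ (L : List X) (a : X), u ∈ a :: L → ∃ L' : List X, L'.Perm (v :: L) ∧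
      listLen (a :: L') ≤ listLen (a :: L) + dist u v := by
  intro L
  induction L with
  | nil =>
    intro a ha
    obtain rfl : u = a := by simpa using ha
    exact insert_head hu v [] u
  | cons b M ih =>
    intro a ha
    rcases List.mem_cons.1 ha with rfl | hb
    · exact insert_head hu v (b :: M) u
    · obtain ⟨L', hp, hw⟩ := ih b hb
      refine ⟨b :: L', (hp.cons b).trans (List.Perm.swap _ _ _), ?_⟩
      simp only [listLen]
      linarith

theorem edgeWeight_nonneg {X : Type*} [MetricSpace X] (e : Sym2 X) : 0 ≤ edgeWeight X e := by
  induction e with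
  | _ a b => exact dist_nonneg

theorem exists_boundary {X : Type*} {G : SimpleGraph X} (S : Set X) {a b : X} (p : G.Walk a b)
    (ha : a ∈ S) (hb : b ∉ S) : ∃ u ∈ S, ∃ v, v ∉ S ∧ G.Adj u v := by
  induction p with
  | nil => exact absurd ha hb
  | @cons a c b h p ih =>
    by_cases hc : c ∈ S
    · exact ih hc hb
    · exact ⟨a, ha, c, hc, h⟩

theorem grow {X : Type*} [MetricSpace X] [Fintype X] [Nonempty X]
    (hu : ∀ x y z : X, dist x y ≤ max (dist x z) (dist z y)) (G : SimpleGraph X)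
    (hG : G.Connected) (k : ℕ) (hk : k + 1 ≤ Fintype.card X) :
    ∃ (a : X) (L : List X) (F : Finset (Sym2 X)), (a :: L).Nodup ∧ L.length = k ∧
      (∀ e ∈ F, e ∈ G.edgeSet ∧ ∀ y ∈ e, y ∈ a :: L) ∧
      listLen (a :: L) ≤ ∑ e ∈ F, edgeWeight X e := by
  classical
  induction k with
  | zero =>
    obtain ⟨a⟩ := ‹Nonempty X›
    exact ⟨a, [], ∅, by simp, rfl, by simp, by simp [listLen]⟩
  | succ k ih =>
    obtain ⟨a, L, F, hn, hl, hF, hw⟩ := ih (by omega)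
    obtain ⟨b, hb⟩ : ∃ b, b ∉ a :: L := by
      by_contra hc
      push Not at hc
      have h1 : (Finset.univ : Finset X) ⊆ (a :: L).toFinset := fun y _ => by
        simpa using hc y
      have h2 := Finset.card_le_card h1
      have h3 := List.toFinset_card_le (a :: L)
      rw [Finset.card_univ] at h2
      simp only [List.length_cons] at h3
      omega
    obtain ⟨p⟩ := hG.preconnected a b
    obtain ⟨u, hu1, v, hv, huv⟩ := exists_boundary {y | y ∈ a :: L} p (by simp) hb
    obtain ⟨L', hp, hw'⟩ := insert_any hu v u L a hu1
    have hp' : (a :: L').Perm (v :: a :: L) := (hp.cons a).trans (List.Perm.swap _ _ _)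
    refine ⟨a, L', insert s(u, v) F, ?_, ?_, ?_, ?_⟩
    · exact hp'.nodup_iff.2 (List.nodup_cons.2 ⟨hv, hn⟩)
    · rw [hp.length_eq]; simp [hl]
    · intro e he
      rcases Finset.mem_insert.1 he with rfl | he
      · refine ⟨huv, fun y hy => hp'.mem_iff.2 ?_⟩
        rcases Sym2.mem_iff.1 hy with rfl | rfl
        · exact List.mem_cons_of_mem _ hu1
        · exact List.mem_cons_self
      · exact ⟨(hF e he).1, fun y hy => hp'.mem_iff.2 (List.mem_cons_of_mem _ ((hF e he).2 y hy))⟩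
    · rw [Finset.sum_insert]
      · have : edgeWeight X s(u, v) = dist u v := rfl
        linarith
      · intro he
        exact hv ((hF _ he).2 v (Sym2.mem_mk_right u v))

theorem listLen_eq {X : Type*} [MetricSpace X] (d : X) : ∀ (L : List X) (a : X),
    listLen (a :: L) = ∑ i ∈ Finset.range L.length,
      dist ((a :: L).getD i d) ((a :: L).getD (i + 1) d) := by
  intro L
  induction L with
  | nil => intro a; simp [listLen]
  | cons b M ih =>
    intro a
    rw [List.length_cons, Finset.sum_range_succ']
    simp only [listLen, ih b, List.getD_cons_succ, List.getD_cons_zero]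
    ring

theorem path_edges {X : Type*} [Fintype X] [DecidableEq X] (n : ℕ) (x : ℕ → X) :
    (pathGraphOn n x).edgeSet.toFinite.toFinset ⊆
      (Finset.range (n - 1)).image (fun i => s(x i, x (i + 1))) := by
  intro e
  induction e with
  | _ u v =>
    intro he
    simp only [Set.Finite.mem_toFinset, SimpleGraph.mem_edgeSet, pathGraphOn,
      SimpleGraph.fromRel_adj] at he
    rw [Finset.mem_image]
    rcases he.2 with ⟨i, hi, rfl, rfl⟩ | ⟨i, hi, rfl, rfl⟩
    · exact ⟨i, Finset.mem_range.2 (by omega), rfl⟩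
    · exact ⟨i, Finset.mem_range.2 (by omega), Sym2.eq_swap⟩

theorem path_weight {X : Type*} [MetricSpace X] [Fintype X] (n : ℕ) (x : ℕ → X) :
    graphWeight (pathGraphOn n x) ≤ ∑ i ∈ Finset.range (n - 1), dist (x i) (x (i + 1)) := by
  classical
  refine (Finset.sum_le_sum_of_subset_of_nonneg (path_edges n x)
    fun e _ _ => edgeWeight_nonneg e).trans ?_
  exact Finset.sum_image_le_of_nonneg fun e _ => edgeWeight_nonneg _

theorem path_tree {X : Type*} [Fintype X] [Nonempty X] (x : ℕ → X)
    (hx : Function.Bijective fun i : Fin (Fintype.card X) => x i.val) :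
    (pathGraphOn (Fintype.card X) x).IsTree := by
  classical
  have hr : ∀ i, i < Fintype.card X →
      (pathGraphOn (Fintype.card X) x).Reachable (x 0) (x i) := by
    intro i
    induction i with
    | zero => exact fun _ => SimpleGraph.Reachable.refl _
    | succ i ih =>
      intro hi
      refine (ih (by omega)).trans (SimpleGraph.Adj.reachable ?_)
      rw [pathGraphOn, SimpleGraph.fromRel_adj]
      refine ⟨fun h => ?_, Or.inl ⟨i, hi, rfl, rfl⟩⟩
      have := hx.1 (a₁ := ⟨i, by omega⟩) (a₂ := ⟨i + 1, hi⟩) h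
      simp at this
  have hc : (pathGraphOn (Fintype.card X) x).Connected := by
    refine ⟨fun a b => ?_⟩
    obtain ⟨i, rfl⟩ := hx.2 a
    obtain ⟨j, rfl⟩ := hx.2 b
    exact (hr i i.2).symm.trans (hr j j.2)
  rw [SimpleGraph.isTree_iff_connected_and_card]
  refine ⟨hc, ?_⟩
  have h1 := hc.card_vert_le_card_edgeSet_add_one
  have h2 := (Finset.card_le_card (path_edges (Fintype.card X) x)).trans Finset.card_image_le
  rw [Finset.card_range, ← Set.ncard_eq_toFinset_card] at h2
  have h3 : Nat.card (pathGraphOn (Fintype.card X) x).edgeSet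
    = (pathGraphOn (Fintype.card X) x).edgeSet.ncard := rfl
  have h4 : 0 < Fintype.card X := Fintype.card_pos
  rw [Nat.card_eq_fintype_card (α := X)] at *
  omega

/-- Every finite nonempty ultrametric space admits a minimum weight spanning tree
which is a Hamiltonian path. -/
theorem exists_min_spanning_path {X : Type*} [MetricSpace X] [Fintype X] [Nonempty X]
    (hu : ∀ x y z : X, dist x y ≤ max (dist x z) (dist z y)) :
    ∃ x : ℕ → X, (Function.Bijective fun i : Fin (Fintype.card X) => x i.val) ∧
      IsMST (pathGraphOn (Fintype.card X) x) := by
  classical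
  obtain ⟨G, hG, hmin⟩ : ∃ G : SimpleGraph X, G.IsTree ∧
      ∀ H : SimpleGraph X, H.IsTree → graphWeight G ≤ graphWeight H := by
    obtain ⟨T, -, hT⟩ := (SimpleGraph.connected_top (V := X)).exists_isTree_le
    obtain ⟨G, hG, h⟩ := Set.exists_min_image {G : SimpleGraph X | G.IsTree} graphWeight
      (Set.toFinite _) ⟨T, hT⟩
    exact ⟨G, hG, h⟩
  have hpos : 0 < Fintype.card X := Fintype.card_pos
  obtain ⟨a, L, F, hn, hl, hF, hw⟩ := grow hu G hG.connected (Fintype.card X - 1) (by omega)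
  have hlen : (a :: L).length = Fintype.card X := by simp only [List.length_cons]; omega
  have hbij : Function.Bijective
      fun i : Fin (Fintype.card X) => (fun j => (a :: L).getD j a) i.val := by
    rw [Fintype.bijective_iff_injective_and_card]
    refine ⟨fun i j hij => ?_, by simp⟩
    have hi : i.val < (a :: L).length := i.2.trans_eq hlen.symm
    have hj : j.val < (a :: L).length := j.2.trans_eq hlen.symm
    simp only [List.getD_eq_getElem _ _ hi, List.getD_eq_getElem _ _ hj] at hij
    exact Fin.ext ((hn.getElem_inj_iff).1 hij)
  refine ⟨fun j => (a :: L).getD j a, hbij, path_tree _ hbij, fun H hH => ?_⟩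
  refine le_trans ?_ (hmin H hH)
  refine (path_weight _ _).trans ?_
  rw [← hl, ← listLen_eq a L a]
  refine hw.trans ?_
  refine Finset.sum_le_sum_of_subset_of_nonneg (fun e he => ?_) fun e _ _ => edgeWeight_nonneg e
  simpa using (hF e he).1
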